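/- For every n ∈ ℕ, the identity x^n = ∑_{k=0}^{⌊n/2⌋} q^{−k} ([n choose k]_q − [n choose k−1]_q) F_{n−2k}(x,q) holds in ℚ(q)[x]. -/

import Mathlib

open Finset Polynomial

/-- The indeterminate `q`, viewed in the field `ℚ(q)` of rational functions. -/
noncomputable def q : RatFunc ℚ := RatFunc.X

/-- The Gaussian binomial coefficient `[n choose k]_q` in `ℚ(q)`. -/
noncomputable def qbinom (n k : ℤ) : RatFunc ℚ :=
  if 0 ≤ k ∧ k ≤ n then
    ∏ i ∈ Finset.range k.toNat, (1 - q ^ (n - k + (i : ℤ) + 1)) / (1 - q ^ ((i : ℤ) + 1))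
  else if k = 0 then 1 else 0

/-- The q-Fibonacci polynomial
`F_n(x,q) = ∑_{j=0}^{⌊n/2⌋} (−1)^j q^{j(j−1)/2} [n−j choose j]_q x^{n−2j}` in `ℚ(q)[x]`. -/
noncomputable def qFib (n : ℕ) : Polynomial (RatFunc ℚ) :=
  ∑ j ∈ Finset.range (n / 2 + 1),
    Polynomial.C ((-1 : RatFunc ℚ) ^ j * q ^ (j * (j - 1) / 2) * qbinom ((n : ℤ) - j) j) *
      Polynomial.X ^ (n - 2 * j)

section GaussianBinomial

variable {R : Type*} [CommRing R]

/-- The Gaussian binomial coefficients with parameter `t`, defined by the `q`-Pascal recursion. -/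
def gaussBinom (t : R) : ℕ → ℕ → R
  | _, 0 => 1
  | 0, _ + 1 => 0
  | n + 1, k + 1 => gaussBinom t n k + t ^ (k + 1) * gaussBinom t n (k + 1)

@[simp]
theorem gaussBinom_zero_right (t : R) (n : ℕ) : gaussBinom t n 0 = 1 := by
  cases n <;> rfl

@[simp]
theorem gaussBinom_zero_succ (t : R) (k : ℕ) : gaussBinom t 0 (k + 1) = 0 := rfl

theorem gaussBinom_succ_succ (t : R) (n k : ℕ) :
    gaussBinom t (n + 1) (k + 1) = gaussBinom t n k + t ^ (k + 1) * gaussBinom t n (k + 1) := rfl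

theorem gaussBinom_eq_zero_of_lt (t : R) {n k : ℕ} (h : n < k) : gaussBinom t n k = 0 := by
  induction n generalizing k with
  | zero => cases k with
    | zero => omega
    | succ k => rfl
  | succ n ih => cases k with
    | zero => omega
    | succ k => rw [gaussBinom_succ_succ, ih (by omega), ih (by omega)]; ring

theorem gaussBinom_succ_right_mul (t : R) (n k : ℕ) :
    t ^ k * (1 - t ^ (k + 1)) * gaussBinom t n (k + 1) = (t ^ k - t ^ n) * gaussBinom t n k := by
  induction n generalizing k with
  | zero => cases k <;> simp
  | succ n ih => cases k with
    | zero =>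
      have h := ih 0
      simp only [gaussBinom_succ_succ, gaussBinom_zero_right] at h ⊢
      linear_combination t * h
    | succ k =>
      rw [gaussBinom_succ_succ, gaussBinom_succ_succ]
      linear_combination t ^ (k + 2) * ih (k + 1) + t * ih k

/-- The absorption identity `[k + 1] [n + 1 choose k + 1] = [n + 1] [n choose k]`. -/
theorem gaussBinom_succ_succ_mul (t : R) (n k : ℕ) :
    (1 - t ^ (k + 1)) * gaussBinom t (n + 1) (k + 1) = (1 - t ^ (n + 1)) * gaussBinom t n k := by
  rw [gaussBinom_succ_succ]
  linear_combination t * gaussBinom_succ_right_mul t n k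

theorem gaussBinom_succ_left_mul (t : R) (n k : ℕ) :
    (t ^ k - t ^ (n + 1)) * gaussBinom t (n + 1) k =
      t ^ k * (1 - t ^ (n + 1)) * gaussBinom t n k := by
  cases k with
  | zero => simp
  | succ k =>
    rw [gaussBinom_succ_succ]
    linear_combination -t * gaussBinom_succ_right_mul t n k

/-- The second form of the `q`-Pascal recursion. -/
theorem gaussBinom_succ_succ_mul_pow (t : R) (n k : ℕ) :
    t ^ k * gaussBinom t (n + 1) (k + 1) =
      t ^ k * gaussBinom t n (k + 1) + t ^ n * gaussBinom t n k := by
  rw [gaussBinom_succ_succ]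
  linear_combination -gaussBinom_succ_right_mul t n k

/-- The difference `[n choose k] - [n choose k - 1]`. -/
def gaussBallot (t : R) (n : ℕ) : ℕ → R
  | 0 => 1
  | k + 1 => gaussBinom t n (k + 1) - gaussBinom t n k

theorem gaussBallot_succ_succ (t : R) (n k : ℕ) :
    gaussBallot t (n + 2) (k + 1) = gaussBallot t (n + 1) (k + 1) + gaussBallot t (n + 1) k +
      (t ^ (n + 1) - 1) * gaussBallot t n k := by
  have key (k : ℕ) : gaussBinom t (n + 2) (k + 1) = gaussBinom t (n + 1) (k + 1) +
      gaussBinom t (n + 1) k + (t ^ (n + 1) - 1) * gaussBinom t n k := by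
    rw [gaussBinom_succ_succ t (n + 1)]
    linear_combination -gaussBinom_succ_succ_mul t n k
  cases k with
  | zero =>
    have h := key 0
    simp only [gaussBallot, gaussBinom_zero_right] at h ⊢
    linear_combination h
  | succ k =>
    simp only [gaussBallot]
    linear_combination key (k + 1) - key k

end GaussianBinomial

theorem q_ne_zero : q ≠ 0 := RatFunc.X_ne_zero

theorem one_sub_q_pow_ne_zero (k : ℕ) : 1 - q ^ (k + 1) ≠ 0 := by
  intro h
  have h' : algebraMap ℚ[X] (RatFunc ℚ) (X ^ (k + 1)) = algebraMap ℚ[X] (RatFunc ℚ) 1 := by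
    rw [map_pow, RatFunc.algebraMap_X, map_one]
    exact (sub_eq_zero.mp h).symm
  simpa using congrArg natDegree (RatFunc.algebraMap_injective ℚ h')

theorem qbinom_natCast (n k : ℕ) : qbinom n k = gaussBinom q n k := by
  rcases lt_or_ge n k with h | h
  · rw [gaussBinom_eq_zero_of_lt q h, qbinom, if_neg (by omega), if_neg (by omega)]
  · obtain ⟨m, rfl⟩ := Nat.exists_eq_add_of_le' h
    have hprod : ∏ i ∈ range k, (1 - q ^ (m + i + 1)) / (1 - q ^ (i + 1)) =
        gaussBinom q (m + k) k := by
      clear h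
      induction k with
      | zero => simp
      | succ k ih =>
        rw [prod_range_succ, ih, ← mul_div_assoc, div_eq_iff (one_sub_q_pow_ne_zero k)]
        linear_combination -gaussBinom_succ_succ_mul q (m + k) k
    rw [qbinom, if_pos (by omega), Int.toNat_natCast, ← hprod]
    refine prod_congr rfl fun i _ ↦ ?_
    rw [show ((m + k : ℕ) : ℤ) - k + i + 1 = (m + i + 1 : ℕ) by push_cast; ring,
      show (i : ℤ) + 1 = (i + 1 : ℕ) by push_cast; ring, zpow_natCast, zpow_natCast]

theorem qbinom_sub_qbinom (n k : ℕ) :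
    qbinom n k - qbinom n ((k : ℤ) - 1) = gaussBallot q n k := by
  cases k with
  | zero =>
    rw [qbinom_natCast]
    simp [qbinom, gaussBallot]
  | succ k =>
    rw [show ((k + 1 : ℕ) : ℤ) - 1 = k by push_cast; ring, qbinom_natCast, qbinom_natCast,
      gaussBallot]

theorem gaussBallot_two_mul_add_one (k : ℕ) : gaussBallot q (2 * k + 1) (k + 1) = 0 := by
  rw [gaussBallot, sub_eq_zero]
  apply mul_left_cancel₀ (mul_ne_zero (pow_ne_zero k q_ne_zero) (one_sub_q_pow_ne_zero k))
  rw [gaussBinom_succ_right_mul]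
  ring

/-- The coefficient of `x ^ (n - 2 * j)` in `F_n(x, q)`. -/
noncomputable def qFibCoeff (n j : ℕ) : RatFunc ℚ :=
  (-1) ^ j * q ^ (j * (j - 1) / 2) * gaussBinom q (n - j) j

theorem qFibCoeff_eq_zero_of_lt {n j : ℕ} (h : n < 2 * j) : qFibCoeff n j = 0 := by
  rw [qFibCoeff, gaussBinom_eq_zero_of_lt q (by omega), mul_zero]

theorem qFibCoeff_succ (r j : ℕ) :
    q * qFibCoeff (2 * j + r + 2) (j + 1) = q * qFibCoeff (2 * j + r + 1) (j + 1) -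
      (q ^ (r + 1) - 1) * qFibCoeff (2 * j + r + 1) j - qFibCoeff (2 * j + r) j := by
  have hexp : (j + 1) * (j + 1 - 1) / 2 = j * (j - 1) / 2 + j := by
    rw [← Finset.sum_range_id, ← Finset.sum_range_id, sum_range_succ]
  have hleft : (1 - q ^ (r + 1)) * gaussBinom q (j + r + 1) j =
      (1 - q ^ (j + r + 1)) * gaussBinom q (j + r) j := by
    apply mul_left_cancel₀ (pow_ne_zero j q_ne_zero)
    linear_combination gaussBinom_succ_left_mul q (j + r) j
  simp only [qFibCoeff, hexp, show 2 * j + r + 2 - (j + 1) = j + r + 1 by omega,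
    show 2 * j + r + 1 - (j + 1) = j + r by omega, show 2 * j + r + 1 - j = j + r + 1 by omega,
    show 2 * j + r - j = j + r by omega]
  linear_combination (-1) ^ (j + 1) * q ^ (j * (j - 1) / 2) *
    (q * gaussBinom_succ_succ_mul_pow q (j + r) j + hleft)

/-- `x ^ (n - 2 * j)`, read as `0` when the exponent is negative. -/
noncomputable def powSubTwoMul (n j : ℕ) : (RatFunc ℚ)[X] :=
  if 2 * j ≤ n then X ^ (n - 2 * j) else 0

theorem powSubTwoMul_succ (n j : ℕ) : powSubTwoMul (n + 2) (j + 1) = powSubTwoMul n j := by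
  simp only [powSubTwoMul, show 2 * (j + 1) ≤ n + 2 ↔ 2 * j ≤ n by omega,
    show n + 2 - 2 * (j + 1) = n - 2 * j by omega]

theorem qFib_eq_sum_range {n N : ℕ} (hN : n / 2 < N) :
    qFib n = ∑ j ∈ range N, qFibCoeff n j • powSubTwoMul n j := by
  rw [qFib]
  refine Eq.trans (sum_congr rfl fun j hj ↦ ?_)
    (sum_subset (range_subset_range.mpr hN) fun j _ hj ↦ ?_)
  · have hj : 2 * j ≤ n := by have := mem_range.mp hj; omega
    rw [← Nat.cast_sub (by omega), qbinom_natCast, powSubTwoMul, if_pos hj, smul_eq_C_mul,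
      qFibCoeff]
  · rw [qFibCoeff_eq_zero_of_lt (by rw [mem_range] at hj; omega), zero_smul]

/-- The linear operator `q x - (q - 1) D`, where `D` is the `q`-derivative. -/
noncomputable def qFibShift : (RatFunc ℚ)[X] →ₗ[RatFunc ℚ] (RatFunc ℚ)[X] :=
  (basisMonomials (RatFunc ℚ)).constr (RatFunc ℚ)
    fun n ↦ q • X ^ (n + 1) - (q ^ n - 1) • X ^ (n - 1)

theorem qFibShift_X_pow (n : ℕ) :
    qFibShift (X ^ n) = q • X ^ (n + 1) - (q ^ n - 1) • X ^ (n - 1) := by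
  rw [← monomial_one_right_eq_X_pow, ← congrFun (coe_basisMonomials (R := RatFunc ℚ)) n, qFibShift,
    Module.Basis.constr_basis]

theorem qFibShift_smul_powSubTwoMul (n j : ℕ) :
    qFibShift (qFibCoeff (n + 1) j • powSubTwoMul (n + 1) j) =
      (q * qFibCoeff (n + 1) j) • powSubTwoMul (n + 2) j -
        ((q ^ (n + 1 - 2 * j) - 1) * qFibCoeff (n + 1) j) • powSubTwoMul n j := by
  rcases lt_or_ge (n + 1) (2 * j) with h | h
  · simp [qFibCoeff_eq_zero_of_lt h]
  · rw [map_smul, powSubTwoMul, powSubTwoMul, powSubTwoMul, if_pos h, if_pos (by omega),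
      qFibShift_X_pow, show n + 1 - 2 * j + 1 = n + 2 - 2 * j by omega,
      show n + 1 - 2 * j - 1 = n - 2 * j by omega]
    split_ifs with h'
    · simp only [smul_eq_C_mul, map_mul, map_sub]
      ring
    · rw [show n + 1 - 2 * j = 0 by omega]
      simp [mul_smul, smul_comm q]

theorem qFib_zero : qFib 0 = 1 := by
  simp [qFib, qbinom]

theorem qFib_one : qFib 1 = X := by
  simp [qFib, qbinom]

theorem qFibShift_qFib_zero : qFibShift (qFib 0) = q • qFib 1 := by
  rw [qFib_zero, qFib_one, ← pow_zero X, qFibShift_X_pow]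
  simp

theorem qFibShift_qFib_succ (n : ℕ) :
    qFibShift (qFib (n + 1)) = q • qFib (n + 2) + qFib n := by
  have hsucc : qFib (n + 1) = ∑ j ∈ range (n + 3), qFibCoeff (n + 1) j • powSubTwoMul (n + 1) j :=
    qFib_eq_sum_range (by omega)
  have htop : qFibCoeff (n + 1) (n + 2) = 0 := qFibCoeff_eq_zero_of_lt (by omega)
  rw [hsucc, qFib_eq_sum_range (show (n + 2) / 2 < n + 3 by omega),
    qFib_eq_sum_range (show n / 2 < n + 2 by omega), map_sum]
  simp only [qFibShift_smul_powSubTwoMul, sum_sub_distrib]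
  rw [sum_range_succ', sum_range_succ' (fun j ↦ qFibCoeff (n + 2) j • powSubTwoMul (n + 2) j),
    sum_range_succ (fun j ↦ ((q ^ (n + 1 - 2 * j) - 1) * qFibCoeff (n + 1) j) • powSubTwoMul n j),
    htop, mul_zero, zero_smul, add_zero, smul_add, smul_sum, add_right_comm, ← sum_add_distrib,
    add_sub_right_comm, ← sum_sub_distrib]
  congr 1
  · refine sum_congr rfl fun j _ ↦ ?_
    rw [powSubTwoMul_succ]
    rcases lt_or_ge n (2 * j) with h | h
    · simp [powSubTwoMul, h.not_ge]
    · obtain ⟨r, rfl⟩ := Nat.exists_eq_add_of_le h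
      rw [smul_smul, qFibCoeff_succ, show 2 * j + r + 1 - 2 * j = r + 1 by omega]
      simp only [smul_eq_C_mul, map_mul, map_sub]
      ring
  · rw [smul_smul]
    simp [qFibCoeff]

/-- `F_{n - 2 k}(x, q)`, read as `0` when the index is negative. -/
noncomputable def qFibSubTwoMul (n k : ℕ) : (RatFunc ℚ)[X] :=
  if 2 * k ≤ n then qFib (n - 2 * k) else 0

theorem qFibSubTwoMul_succ (n k : ℕ) : qFibSubTwoMul (n + 2) (k + 1) = qFibSubTwoMul n k := by
  simp only [qFibSubTwoMul, show 2 * (k + 1) ≤ n + 2 ↔ 2 * k ≤ n by omega,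
    show n + 2 - 2 * (k + 1) = n - 2 * k by omega]

theorem gaussBallot_smul_qFibShift (n k : ℕ) :
    gaussBallot q (n + 1) k • qFibShift (qFibSubTwoMul (n + 1) k) =
      gaussBallot q (n + 1) k • (q • qFibSubTwoMul (n + 2) k + qFibSubTwoMul n k) := by
  rcases lt_trichotomy (2 * k) (n + 1) with h | h | h
  · obtain ⟨r, rfl⟩ := Nat.exists_eq_add_of_le (show 2 * k ≤ n by omega)
    simp only [qFibSubTwoMul]
    rw [if_pos (by omega), if_pos (by omega), if_pos (by omega),
      show 2 * k + r + 1 - 2 * k = r + 1 by omega, show 2 * k + r + 2 - 2 * k = r + 2 by omega,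
      show 2 * k + r - 2 * k = r by omega, qFibShift_qFib_succ]
  · simp only [qFibSubTwoMul]
    rw [if_pos (by omega), if_pos (by omega), if_neg (by omega),
      show n + 1 - 2 * k = 0 by omega, show n + 2 - 2 * k = 1 by omega, qFibShift_qFib_zero,
      add_zero]
  · rcases eq_or_ne (2 * k) (n + 2) with h' | h'
    · obtain ⟨k, rfl⟩ := Nat.exists_eq_add_of_le' (show 1 ≤ k by omega)
      rw [show n + 1 = 2 * k + 1 by omega, gaussBallot_two_mul_add_one, zero_smul, zero_smul]
    · simp only [qFibSubTwoMul]
      rw [if_neg (by omega), if_neg (by omega), if_neg (by omega)]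
      simp

theorem X_pow_eq_sum_qFibSubTwoMul (n N : ℕ) (hN : n / 2 < N) :
    (X : (RatFunc ℚ)[X]) ^ n =
      ∑ k ∈ range N, (q⁻¹ ^ k * gaussBallot q n k) • qFibSubTwoMul n k := by
  have hq := q_ne_zero
  induction n using Nat.twoStepInduction generalizing N with
  | zero =>
    rw [sum_eq_single_of_mem 0 (by simpa using hN) fun k _ hk ↦ by simp [qFibSubTwoMul, hk]]
    simp [qFibSubTwoMul, gaussBallot, qFib_zero]
  | one =>
    rw [sum_eq_single_of_mem 0 (by simpa using hN) fun k _ hk ↦ by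
      rw [qFibSubTwoMul, if_neg (by omega), smul_zero]]
    simp [qFibSubTwoMul, gaussBallot, qFib_one]
  | more n ih ih' =>
    obtain ⟨N, rfl⟩ := Nat.exists_eq_add_of_le' (show 1 ≤ N by omega)
    have hX : (X : (RatFunc ℚ)[X]) ^ (n + 2) =
        q⁻¹ • (qFibShift (X ^ (n + 1)) + (q ^ (n + 1) - 1) • X ^ n) := by
      rw [qFibShift_X_pow, Nat.add_sub_cancel, sub_add_cancel, smul_smul, inv_mul_cancel₀ hq,
        one_smul]
    have hshift : qFibShift (X ^ (n + 1)) =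
        q • ∑ k ∈ range (N + 1), (q⁻¹ ^ k * gaussBallot q (n + 1) k) • qFibSubTwoMul (n + 2) k +
          ∑ k ∈ range N, (q⁻¹ ^ k * gaussBallot q (n + 1) k) • qFibSubTwoMul n k := by
      have hlast : qFibSubTwoMul n N = 0 := if_neg (by omega)
      have hext : ∑ k ∈ range N, (q⁻¹ ^ k * gaussBallot q (n + 1) k) • qFibSubTwoMul n k =
          ∑ k ∈ range (N + 1), (q⁻¹ ^ k * gaussBallot q (n + 1) k) • qFibSubTwoMul n k := by
        rw [sum_range_succ, hlast, smul_zero, add_zero]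
      rw [hext, ih' (N + 1) (by omega), map_sum, smul_sum, ← sum_add_distrib]
      refine sum_congr rfl fun k _ ↦ ?_
      rw [map_smul, mul_smul, gaussBallot_smul_qFibShift]
      simp only [smul_eq_C_mul, map_mul]
      ring
    rw [hX, hshift, ih N (by omega), sum_range_succ', sum_range_succ']
    simp only [qFibSubTwoMul_succ, gaussBallot_succ_succ, smul_add, smul_sum, smul_smul]
    rw [add_right_comm, add_right_comm (∑ k ∈ range N, _), ← sum_add_distrib, add_right_comm,
      ← sum_add_distrib]
    congr 1
    · refine sum_congr rfl fun k _ ↦ ?_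
      rw [← add_smul, ← add_smul]
      congr 1
      rw [inv_mul_cancel_left₀ hq]
      ring
    · simp [gaussBallot, hq]

theorem pow_eq_sum_qFib (n : ℕ) :
    (Polynomial.X : Polynomial (RatFunc ℚ)) ^ n =
      ∑ k ∈ Finset.range (n / 2 + 1),
        Polynomial.C (q ^ (-(k : ℤ)) * (qbinom n k - qbinom n ((k : ℤ) - 1))) *
          qFib (n - 2 * k) := by
  rw [X_pow_eq_sum_qFibSubTwoMul n _ (Nat.lt_succ_self _)]
  refine sum_congr rfl fun k hk ↦ ?_
  rw [qFibSubTwoMul, if_pos (by have := mem_range.mp hk; omega), qbinom_sub_qbinom,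
    smul_eq_C_mul, zpow_neg, zpow_natCast, inv_pow]
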